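/- arXiv:1804.09897 — 2 statements merged into one kernel-verified Lean document; each statement's English description precedes it below -/
import Mathlib

section
/- Let S be a quasi completely regular semiring with least b-lattice congruence ξ, and let 𝒴* be the least congruence on S containing 𝒴. Then 𝒴* is the equality relation on S if and only if for every ξ-class S_α (regarded as a subsemiring of S), the equality relation is the unique generalized additive idempotent pure congruence on S_α. -/
/-- A "semiring" in the sense of the paper: both reducts are semigroups
(no commutativity, no identities) and multiplication distributes over
addition on both sides. -/
class PSemiring (S : Type*) extends AddSemigroup S, Semigroup S where
  left_distrib : ∀ a b c : S, a * (b + c) = a * b + a * c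
  right_distrib : ∀ a b c : S, (a + b) * c = a * c + b * c

namespace PSemiring

variable {S : Type*} [PSemiring S]

/-- `nmul n a` is the `(n+1)`-fold sum `a + ⋯ + a`; thus the positive
multiple `m·a` of the paper is `nmul (m-1) a`. -/
def nmul : ℕ → S → S
  | 0, a => a
  | n + 1, a => nmul n a + a

/-- `a` is additively regular. -/
def AddRegular (a : S) : Prop := ∃ x, a + x + a = a

/-- `a` is a completely regular element. -/
def CompletelyRegularElem (a : S) : Prop :=
  ∃ x, a = a + x + a ∧ a + x = x + a ∧ a * (a + x) = a + x

/-- `S` is a quasi completely regular semiring. -/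
def QuasiCompletelyRegular (S : Type*) [PSemiring S] : Prop :=
  ∀ a : S, ∃ n : ℕ, CompletelyRegularElem (nmul n a)

/-- `S` is a completely regular semiring. -/
def CompletelyRegularSemiring (S : Type*) [PSemiring S] : Prop :=
  ∀ a : S, CompletelyRegularElem a

/-- `e` is an additive idempotent (i.e. `e ∈ E⁺(S)`). -/
def AddIdem (e : S) : Prop := e + e = e

/-- `V⁺(a)`, the set of additive inverses of `a`. -/
def Vplus (a : S) : Set S := {x | a + x + a = a ∧ x + a + x = x}

/-- `{a} ∪ (S + a)`. -/
def lset (a : S) : Set S := insert a {x | ∃ s, x = s + a}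

/-- `{a} ∪ (a + S)`. -/
def rset (a : S) : Set S := insert a {x | ∃ s, x = a + s}

/-- `{a} ∪ (S + a) ∪ (a + S) ∪ (S + a + S)`. -/
def jset (a : S) : Set S :=
  insert a ({x | ∃ s, x = s + a} ∪ {x | ∃ s, x = a + s} ∪ {x | ∃ s t, x = s + a + t})

/-- Green's relation `L⁺` on the additive reduct. -/
def GreenL (a b : S) : Prop := lset a = lset b

/-- Green's relation `R⁺` on the additive reduct. -/
def GreenR (a b : S) : Prop := rset a = rset b

/-- Green's relation `J⁺` on the additive reduct. -/
def GreenJ (a b : S) : Prop := jset a = jset b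

/-- `n` is the least index such that the `(n+1)`-fold sum of `a` is additively
regular, i.e. `(n+1)·a` is the least additively regular positive multiple. -/
def LeastReg (a : S) (n : ℕ) : Prop :=
  AddRegular (nmul n a) ∧ ∀ m < n, ¬ AddRegular (nmul m a)

/-- The relation `L*⁺`. -/
def LStar (a b : S) : Prop :=
  ∃ p q, LeastReg a p ∧ LeastReg b q ∧ GreenL (nmul p a) (nmul q b)

/-- The relation `R*⁺`. -/
def RStar (a b : S) : Prop :=
  ∃ p q, LeastReg a p ∧ LeastReg b q ∧ GreenR (nmul p a) (nmul q b)

/-- The relation `J*⁺`. -/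
def JStar (a b : S) : Prop :=
  ∃ p q, LeastReg a p ∧ LeastReg b q ∧ GreenJ (nmul p a) (nmul q b)

/-- `H*⁺ = L*⁺ ∩ R*⁺`. -/
def HStar (a b : S) : Prop := LStar a b ∧ RStar a b

/-- `D*⁺ = L*⁺ ∘ R*⁺` (relational composition). -/
def DStar (a b : S) : Prop := ∃ c, LStar a c ∧ RStar c b

/-- `z = 0_a`: `z = na + x` where `n` is the least positive integer with `na`
completely regular and `x` is the (unique) element with `na = na+x+na`,
`x = x+na+x` and `na+x = x+na`. -/
def IsZeroOf (a z : S) : Prop :=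
  ∃ n x, (CompletelyRegularElem (nmul n a) ∧
      ∀ m < n, ¬ CompletelyRegularElem (nmul m a)) ∧
    nmul n a = nmul n a + x + nmul n a ∧ x = x + nmul n a + x ∧
    nmul n a + x = x + nmul n a ∧ z = nmul n a + x

/-- The relation `𝒴`, relative to a choice `z` of the map `a ↦ 0_a`. -/
def Yrel (z : S → S) (a b : S) : Prop := Vplus (a + z a) = Vplus (b + z b)

/-- A (semiring) congruence. -/
structure IsCong (r : S → S → Prop) : Prop where
  refl : ∀ a, r a a
  symm : ∀ {a b}, r a b → r b a
  trans : ∀ {a b c}, r a b → r b c → r a c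
  addl : ∀ (c : S) {a b}, r a b → r (c + a) (c + b)
  addr : ∀ (c : S) {a b}, r a b → r (a + c) (b + c)
  mull : ∀ (c : S) {a b}, r a b → r (c * a) (c * b)
  mulr : ∀ (c : S) {a b}, r a b → r (a * c) (b * c)

/-- `r` is a b-lattice congruence: `S/r` is a b-lattice. -/
def IsBLatticeCong (r : S → S → Prop) : Prop :=
  IsCong r ∧ (∀ a : S, r (a * a) a) ∧ (∀ a : S, r (a + a) a) ∧
    ∀ a b : S, r (a + b) (b + a)

/-- `r` is the least b-lattice congruence. -/
def IsLeastBLatticeCong (r : S → S → Prop) : Prop :=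
  IsBLatticeCong r ∧ ∀ r', IsBLatticeCong r' → ∀ a b, r a b → r' a b

/-- `r` is a skew-ring congruence: `S/r` is a semiring whose additive reduct
is a group (expressed by solvability of both translation equations). -/
def IsSkewRingCong (r : S → S → Prop) : Prop :=
  IsCong r ∧ ∀ a b : S, (∃ x, r (a + x) b) ∧ ∃ y, r (y + a) b

/-- `r` is the least skew-ring congruence. -/
def IsLeastSkewRingCong (r : S → S → Prop) : Prop :=
  IsSkewRingCong r ∧ ∀ r', IsSkewRingCong r' → ∀ a b, r a b → r' a b

/-- `η` is a b-lattice-of-skew-rings congruence: `S/η` admits a congruence `ξ`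
(given here as a congruence on `S` containing `η`) such that `(S/η)/ξ` is a
b-lattice and every `ξ`-class of `S/η` is a subsemiring whose additive reduct
is a group. -/
def IsBLSRCong (η : S → S → Prop) : Prop :=
  IsCong η ∧ ∃ ξ : S → S → Prop, IsCong ξ ∧ (∀ a b, η a b → ξ a b) ∧
    (∀ a : S, ξ (a * a) a) ∧ (∀ a : S, ξ (a + a) a) ∧
    (∀ a b : S, ξ (a + b) (b + a)) ∧
    (∀ a b, ξ a b → ξ (a + b) a ∧ ξ (a * b) a) ∧
    ∀ a b, ξ a b → (∃ x, ξ x a ∧ η (a + x) b) ∧ ∃ y, ξ y a ∧ η (y + a) b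

/-- `ν` is the least b-lattice-of-skew-rings congruence. -/
def IsLeastBLSRCong (ν : S → S → Prop) : Prop :=
  IsBLSRCong ν ∧ ∀ η, IsBLSRCong η → ∀ a b, ν a b → η a b

/-- `r` is a completely regular semiring congruence: `S/r` is completely
regular. -/
def IsCRCong (r : S → S → Prop) : Prop :=
  IsCong r ∧ ∀ a : S, ∃ x, r a (a + x + a) ∧ r (a + x) (x + a) ∧
    r (a * (a + x)) (a + x)

/-- `ρ` is the least completely regular semiring congruence. -/
def IsLeastCRCong (r : S → S → Prop) : Prop :=
  IsCRCong r ∧ ∀ r', IsCRCong r' → ∀ a b, r a b → r' a b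

/-- `S` is quasi-orthodox. -/
def QuasiOrthodox (S : Type*) [PSemiring S] : Prop :=
  ∀ e f : S, AddIdem e → AddIdem f →
    ∃ n : ℕ, nmul n (e + f) = nmul (n + 1) (e + f)

/-- `S` is a completely Archimedean semiring. -/
def CompletelyArchimedean (S : Type*) [PSemiring S] : Prop :=
  QuasiCompletelyRegular S ∧ ∀ a b : S, JStar a b

/-- `r` is the least congruence containing the relation `τ`. -/
def IsLeastCongContaining (τ r : S → S → Prop) : Prop :=
  IsCong r ∧ (∀ a b, τ a b → r a b) ∧
    ∀ r', IsCong r' → (∀ a b, τ a b → r' a b) → ∀ a b, r a b → r' a b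

/-- `r` is a generalized additive idempotent pure congruence (purity part). -/
def GenAddIdemPure (r : S → S → Prop) : Prop :=
  ∀ a e : S, AddIdem e → r a e → ∃ n : ℕ, nmul n a = nmul (n + 1) a

/-- `τ^e`: `a = x + c + y`, `b = x + d + y` for some `(c,d) ∈ τ`, where each of
`x`, `y` may also be absent (i.e. `x, y ∈ S⁰`). -/
def relE (τ : S → S → Prop) (a b : S) : Prop :=
  ∃ c d, τ c d ∧ ((a = c ∧ b = d) ∨ (∃ x, a = x + c ∧ b = x + d) ∨
    (∃ y, a = c + y ∧ b = d + y) ∨ ∃ x y, a = x + c + y ∧ b = x + d + y)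

/-- `τ^♮`: the transitive closure of `(τ ∪ τ⁻¹ ∪ ε)^e`. -/
def natClosure (τ : S → S → Prop) : S → S → Prop :=
  Relation.TransGen (relE (fun a b => τ a b ∨ τ b a ∨ a = b))

end PSemiring

open PSemiring

/-- A congruence on the subsemiring determined by the subset `C` of `S`. -/
def IsCongOn {S : Type*} [PSemiring S] (C : Set S) (r : S → S → Prop) : Prop :=
  (∀ a ∈ C, r a a) ∧
  (∀ a ∈ C, ∀ b ∈ C, r a b → r b a) ∧
  (∀ a ∈ C, ∀ b ∈ C, ∀ c ∈ C, r a b → r b c → r a c) ∧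
  ∀ a ∈ C, ∀ b ∈ C, ∀ c ∈ C, r a b →
    r (c + a) (c + b) ∧ r (a + c) (b + c) ∧ r (c * a) (c * b) ∧ r (a * c) (b * c)

/-- `r` is generalized additive idempotent pure on the subsemiring `C`. -/
def GenPureOn {S : Type*} [PSemiring S] (C : Set S) (r : S → S → Prop) : Prop :=
  ∀ a ∈ C, ∀ e ∈ C, PSemiring.AddIdem e → r a e →
    ∃ n : ℕ, PSemiring.nmul n a = PSemiring.nmul (n + 1) a

namespace PSemiring

section Multiples

variable {S : Type*} [PSemiring S]

theorem nmul_succ_left (n : ℕ) (a : S) : nmul (n + 1) a = a + nmul n a := by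
  induction n with
  | zero => rfl
  | succ n ih =>
    change nmul (n + 1) a + a = a + (nmul n a + a)
    rw [ih, add_assoc]

theorem AddIdem.nmul_eq {e : S} (he : AddIdem e) (n : ℕ) : nmul n e = e := by
  induction n with
  | zero => rfl
  | succ n ih =>
    change nmul n e + e = e
    rw [ih]
    exact he

theorem AddIdem.mul_left {e : S} (he : AddIdem e) (a : S) : AddIdem (a * e) := by
  have h := left_distrib a e e
  rw [he] at h
  exact h.symm

theorem AddIdem.mul_right {e : S} (he : AddIdem e) (a : S) : AddIdem (e * a) := by
  have h := right_distrib e e a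
  rw [he] at h
  exact h.symm

theorem AddIdem.mul_nmul {e : S} (he : AddIdem e) (n : ℕ) (a : S) :
    e * nmul n a = e * a := by
  induction n with
  | zero => rfl
  | succ n ih =>
    change e * (nmul n a + a) = e * a
    rw [left_distrib, ih]
    exact he.mul_right a

theorem AddIdem.nmul_mul {e : S} (he : AddIdem e) (n : ℕ) (a : S) :
    nmul n a * e = a * e := by
  induction n with
  | zero => rfl
  | succ n ih =>
    change (nmul n a + a) * e = a * e
    rw [right_distrib, ih]
    exact he.mul_left a

end Multiples

/-- The properties of the map `a ↦ 0_a` used below. -/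
structure IsZeroMap {S : Type*} [PSemiring S] (z : S → S) : Prop where
  idem : ∀ a, AddIdem (z a)
  comm : ∀ a, z a + a = a + z a
  apply_idem : ∀ {e}, AddIdem e → z e = e
  idem_mul_self : ∀ {e : S}, AddIdem e → e * e = e
  idem_mul : ∀ {e : S}, AddIdem e → ∀ a, e * z a = e * a
  mul_idem : ∀ {e : S}, AddIdem e → ∀ a, z a * e = a * e
  exists_add : ∀ a, ∃ t, a + t = z a
  exists_add' : ∀ a, ∃ t, t + a = z a
  exists_nmul : ∀ a, ∃ n, nmul n a + z a = nmul n a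

theorem isZeroMap_of_isZeroOf {S : Type*} [PSemiring S] (hS : QuasiCompletelyRegular S)
    {z : S → S} (hz : ∀ a, IsZeroOf a (z a)) : IsZeroMap z where
  idem a := by
    obtain ⟨n, x, -, h1, h2, h3, h4⟩ := hz a
    unfold AddIdem
    grind
  comm a := by
    obtain ⟨n, x, -, h1, h2, h3, h4⟩ := hz a
    have hc : nmul n a + a = a + nmul n a := nmul_succ_left n a
    have hN : z a + nmul n a = nmul n a := by grind
    have hN' : nmul n a + z a = nmul n a := by grind
    have h5 : a + z a = z a + a + z a := by
      calc a + z a = nmul n a + a + x := by rw [h4, ← add_assoc, hc]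
        _ = z a + (nmul n a + a) + x := by rw [← add_assoc, hN]
        _ = z a + a + (nmul n a + x) := by rw [hc]; simp only [add_assoc]
        _ = z a + a + z a := by rw [← h4]
    have h6 : z a + a = z a + a + z a := by
      calc z a + a = x + (a + nmul n a) := by rw [h4, h3, add_assoc, hc]
        _ = x + (a + nmul n a) + z a := by rw [add_assoc, add_assoc, hN']
        _ = x + nmul n a + a + z a := by rw [← hc]; simp only [add_assoc]
        _ = z a + a + z a := by rw [← h3, ← h4]
    rw [h5, ← h6]
  apply_idem {e} he := by
    obtain ⟨n, x, -, h1, h2, h3, h4⟩ := hz e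
    rw [he.nmul_eq] at *
    unfold AddIdem at he
    grind
  idem_mul_self {e} he := by
    obtain ⟨n, x, h1, h2, h3⟩ := hS e
    rw [he.nmul_eq] at *
    unfold AddIdem at he
    have : e + x = e := by grind
    rwa [this] at h3
  idem_mul {e} he a := by
    obtain ⟨n, x, -, h1, h2, h3, h4⟩ := hz a
    have i1 := he.mul_right (nmul n a)
    have i2 := congrArg (e * ·) h1
    have i3 := congrArg (e * ·) h3
    simp only [left_distrib] at i2 i3
    rw [h4, left_distrib, ← he.mul_nmul n a]
    unfold AddIdem at i1
    grind
  mul_idem {e} he a := by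
    obtain ⟨n, x, -, h1, h2, h3, h4⟩ := hz a
    have i1 := he.mul_left (nmul n a)
    have i2 := congrArg (· * e) h1
    have i3 := congrArg (· * e) h3
    simp only [right_distrib] at i2 i3
    rw [h4, right_distrib, ← he.nmul_mul n a]
    unfold AddIdem at i1
    grind
  exists_add a := by
    obtain ⟨n, x, -, h1, h2, h3, h4⟩ := hz a
    cases n with
    | zero => exact ⟨x, h4.symm⟩
    | succ n => exact ⟨nmul n a + x, by rw [h4, nmul_succ_left, add_assoc]⟩
  exists_add' a := by
    obtain ⟨n, x, -, h1, h2, h3, h4⟩ := hz a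
    rw [h3] at h4
    cases n with
    | zero => exact ⟨x, h4.symm⟩
    | succ n => exact ⟨x + nmul n a, by rw [h4, add_assoc]; rfl⟩
  exists_nmul a := by
    obtain ⟨n, x, -, h1, h2, h3, h4⟩ := hz a
    exact ⟨n, by grind⟩

section Sandwich

variable {S : Type*} [AddSemigroup S]

theorem sandwich_of_eq {a c p q : S} (h : a = p + c + q)
    (hpc : (p + c) + (p + c) = p + c) (hca : (c + a) + (c + a) = c + a) :
    a + c + a = a := by
  have h' : a = p + (c + a) := by
    calc a = (p + c) + (p + c) + q := by rw [hpc, h]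
      _ = p + (c + (p + c + q)) := by simp only [add_assoc]
      _ = p + (c + a) := by rw [← h]
  calc a + c + a = p + (c + a) + (c + a) := by rw [← h', add_assoc]
    _ = a := by rw [add_assoc, hca, ← h']

theorem sandwich_add {x b c : S} (hb : x + b + x = x) (hc : x + c + x = x)
    (h : (b + x + c) + (b + x + c) = b + x + c) : x + (c + b) + x = x := by
  grind

/-- Maps into the additive idempotents that preserve sums. -/
structure IsBandMap {S T : Type*} [Add S] [Add T] (f : S → T) : Prop where
  add : ∀ a b, f (a + b) = f a + f b
  idem : ∀ a, f a + f a = f a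

variable {T : Type*} [AddSemigroup T] {f : S → T}

theorem IsBandMap.sandwich_trans (hf : IsBandMap f) {a b c : S}
    (hab : f a + f b + f a = f a) (hbc : f b + f c + f b = f b) :
    f a + f c + f a = f a := by
  have h1 := hf.idem (a + b + c)
  have h2 := hf.idem (c + a)
  simp only [hf.add] at h1 h2
  exact sandwich_of_eq (q := f b + f a) (by grind) h1 h2

theorem IsBandMap.sandwich_add_left (hf : IsBandMap f) (c : S) {a b : S}
    (hab : f a + f b + f a = f a) :
    f (c + a) + f (c + b) + f (c + a) = f (c + a) := by
  have h1 := hf.idem (c + a + b)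
  have h2 := hf.idem (b + c + a)
  have h3 := hf.idem (b + (c + a) + c)
  have h4 := hf.idem c
  have h5 := hf.idem (c + a)
  simp only [hf.add] at *
  refine sandwich_add ?_ (by grind) h3
  exact sandwich_of_eq (q := f a) (by grind) h1 (by grind)

theorem IsBandMap.sandwich_add_right (hf : IsBandMap f) (c : S) {a b : S}
    (hab : f a + f b + f a = f a) :
    f (a + c) + f (b + c) + f (a + c) = f (a + c) := by
  have h1 := hf.idem (a + b)
  have h2 := hf.idem (b + a + c)
  have h3 := hf.idem (c + (a + c) + b)
  have h4 := hf.idem c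
  have h5 := hf.idem (a + c)
  simp only [hf.add] at *
  refine sandwich_add (by grind) ?_ h3
  exact sandwich_of_eq (q := f a + f c) (by grind) h1 (by grind)

theorem IsBandMap.sandwich_comm (hf : IsBandMap f) (a b : S) :
    f (a + b) + f (b + a) + f (a + b) = f (a + b) := by
  have h1 := hf.idem (a + b)
  have h2 := hf.idem a
  have h3 := hf.idem b
  have h4 := hf.idem (a + (a + b) + b)
  simp only [hf.add] at *
  exact sandwich_add (by grind) (by grind) h4

end Sandwich

/-- Every additive idempotent sees `a` below `b`. -/
def DomBy {S : Type*} [PSemiring S] (a b : S) : Prop :=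
  ∀ e : S, AddIdem e → e * a + e * b + e * a = e * a ∧ a * e + b * e + a * e = a * e

section Dom

variable {S : Type*} [PSemiring S]

theorem AddIdem.isBandMap_mul_left {e : S} (he : AddIdem e) : IsBandMap (e * ·) :=
  ⟨left_distrib e, he.mul_right⟩

theorem AddIdem.isBandMap_mul_right {e : S} (he : AddIdem e) : IsBandMap (· * e) :=
  ⟨fun a b => right_distrib a b e, he.mul_left⟩

theorem DomBy.of_forall_eq {a b : S}
    (h : ∀ e : S, AddIdem e → e * a = e * b ∧ a * e = b * e) : DomBy a b := by
  intro e he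
  have h1 := he.mul_right b
  have h2 := he.mul_left b
  unfold AddIdem at h1 h2
  rw [(h e he).1, (h e he).2, h1, h1, h2, h2]
  exact ⟨rfl, rfl⟩

theorem DomBy.refl (a : S) : DomBy a a :=
  .of_forall_eq fun _ _ => ⟨rfl, rfl⟩

theorem DomBy.trans {a b c : S} (hab : DomBy a b) (hbc : DomBy b c) : DomBy a c :=
  fun e he =>
    ⟨he.isBandMap_mul_left.sandwich_trans (hab e he).1 (hbc e he).1,
      he.isBandMap_mul_right.sandwich_trans (hab e he).2 (hbc e he).2⟩

theorem DomBy.add_left (c : S) {a b : S} (h : DomBy a b) : DomBy (c + a) (c + b) :=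
  fun e he =>
    ⟨he.isBandMap_mul_left.sandwich_add_left c (h e he).1,
      he.isBandMap_mul_right.sandwich_add_left c (h e he).2⟩

theorem DomBy.add_right (c : S) {a b : S} (h : DomBy a b) : DomBy (a + c) (b + c) :=
  fun e he =>
    ⟨he.isBandMap_mul_left.sandwich_add_right c (h e he).1,
      he.isBandMap_mul_right.sandwich_add_right c (h e he).2⟩

theorem DomBy.add_comm (a b : S) : DomBy (a + b) (b + a) :=
  fun _ he =>
    ⟨he.isBandMap_mul_left.sandwich_comm a b, he.isBandMap_mul_right.sandwich_comm a b⟩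

theorem DomBy.mul_left (c : S) {a b : S} (h : DomBy a b) : DomBy (c * a) (c * b) :=
  fun e he =>
    ⟨by simpa only [mul_assoc] using (h (e * c) (he.mul_right c)).1,
      by simpa only [left_distrib, mul_assoc] using congrArg (c * ·) (h e he).2⟩

theorem DomBy.mul_right (c : S) {a b : S} (h : DomBy a b) : DomBy (a * c) (b * c) :=
  fun e he =>
    ⟨by simpa only [right_distrib, mul_assoc] using congrArg (· * c) (h e he).1,
      by simpa only [mul_assoc] using (h (c * e) (he.mul_left c)).2⟩

theorem IsZeroMap.idem_mul_mul_self {z : S → S} (hz : IsZeroMap z) {e : S} (he : AddIdem e)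
    (a : S) : e * (a * a) = e * a ∧ a * a * e = a * e := by
  have hl : a * z a = z a := by rw [← hz.mul_idem (hz.idem a), hz.idem_mul_self (hz.idem a)]
  have hr : z a * a = z a := by rw [← hz.idem_mul (hz.idem a), hz.idem_mul_self (hz.idem a)]
  constructor
  · rw [← mul_assoc, ← hz.idem_mul (he.mul_right a), mul_assoc, hl, hz.idem_mul he]
  · rw [mul_assoc, ← hz.mul_idem (he.mul_left a), ← mul_assoc, hr, hz.mul_idem he]

theorem IsZeroMap.isBLatticeCong_domBy {z : S → S} (hz : IsZeroMap z) :
    IsBLatticeCong fun a b : S => DomBy a b ∧ DomBy b a := by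
  refine ⟨⟨fun a => ⟨.refl a, .refl a⟩, And.symm,
    fun h h' => ⟨h.1.trans h'.1, h'.2.trans h.2⟩,
    fun c _ _ h => ⟨h.1.add_left c, h.2.add_left c⟩,
    fun c _ _ h => ⟨h.1.add_right c, h.2.add_right c⟩,
    fun c _ _ h => ⟨h.1.mul_left c, h.2.mul_left c⟩,
    fun c _ _ h => ⟨h.1.mul_right c, h.2.mul_right c⟩⟩,
    fun a => ?_, fun a => ?_, fun a b => ⟨.add_comm a b, .add_comm b a⟩⟩
  · exact ⟨.of_forall_eq fun e he => hz.idem_mul_mul_self he a,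
      .of_forall_eq fun e he =>
        ⟨(hz.idem_mul_mul_self he a).1.symm, (hz.idem_mul_mul_self he a).2.symm⟩⟩
  · have h : ∀ e : S, AddIdem e → e * (a + a) = e * a ∧ (a + a) * e = a * e := fun e he =>
      ⟨by rw [left_distrib]; exact he.mul_right a, by rw [right_distrib]; exact he.mul_left a⟩
    exact ⟨.of_forall_eq h, .of_forall_eq fun e he => ⟨(h e he).1.symm, (h e he).2.symm⟩⟩

theorem IsZeroMap.ext {z : S → S} (hz : IsZeroMap z) {a b : S}
    (h : ∀ e : S, AddIdem e → e * a = e * b ∧ a * e = b * e) : z a = z b :=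
  calc z a = z a * z a := (hz.idem_mul_self (hz.idem a)).symm
    _ = z a * z b := by
      rw [hz.idem_mul (hz.idem a), (h _ (hz.idem a)).1, hz.idem_mul (hz.idem a)]
    _ = z b * z b := by
      rw [hz.mul_idem (hz.idem b), (h _ (hz.idem b)).2, hz.mul_idem (hz.idem b)]
    _ = z b := hz.idem_mul_self (hz.idem b)

end Dom

theorem cancel_left_of_sandwich {M : Type*} [AddSemigroup M] {x a b v T t s d d' X A B D D' : M}
    (hdb : d' + b = b) (hxd : x + d = x) (hxd' : x + d' = x)
    (hT : a + T = d) (hs : s + D + d' = d') (hD : D + d + D = D) (hD' : D' + d' + D' = D')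
    (hA : D + A = A) (hB : D' + B = B) (hDD : D + D' = D) (hX : t + X = D)
    (hr : D + a + (T + A + v) = D + b + (T + A + v))
    (hr' : x + a + (T + A + v) = x + b + (T + A + v))
    (h : X + A + v = X + B + v) : x + A + v = x + B + v := by
  have e1 : D + A + v = D + B + v := by
    rw [← hX, add_assoc t, add_assoc t, h, add_assoc t, add_assoc t]
  have e2 : D + (b + (T + A + v)) = D + (d' + B + v) := by
    calc D + (b + (T + A + v)) = D + (a + T) + A + v := by
          rw [← add_assoc D, ← hr]; simp only [add_assoc]
      _ = D + d + (D + A) + v := by rw [hT, hA]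
      _ = D + A + v := by rw [← add_assoc, hD]
      _ = D + D' + B + v := by rw [e1, hDD]
      _ = D + (D' + d' + D') + B + v := by rw [hD']
      _ = D + D' + d' + (D' + B) + v := by simp only [add_assoc]
      _ = D + (d' + B + v) := by rw [hDD, hB]; simp only [add_assoc]
  have e3 : b + (T + A + v) = d' + B + v := by
    calc b + (T + A + v) = s + D + d' + b + (T + A + v) := by rw [hs, hdb]
      _ = s + D + (d' + b) + (T + A + v) := by simp only [add_assoc]
      _ = s + (D + (b + (T + A + v))) := by rw [hdb]; simp only [add_assoc]
      _ = s + D + d' + B + v := by rw [e2]; simp only [add_assoc]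
      _ = d' + B + v := by rw [hs]
  calc x + A + v = x + (a + T) + A + v := by rw [hT, hxd]
    _ = x + a + (T + A + v) := by simp only [add_assoc]
    _ = x + d' + B + v := by rw [hr', add_assoc x b, e3]; simp only [add_assoc]
    _ = x + B + v := by rw [hxd']

theorem cancel_right_of_sandwich {M : Type*} [AddSemigroup M]
    {x a b v T t s d d' X A B D D' : M}
    (hdb : b + d' = b) (hxd : d + x = x) (hxd' : d' + x = x)
    (hT : T + a = d) (hs : d' + D + s = d') (hD : D + d + D = D) (hD' : D' + d' + D' = D')
    (hA : A + D = A) (hB : B + D' = B) (hDD : D' + D = D) (hX : X + t = D)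
    (hr : v + A + T + a + D = v + A + T + b + D)
    (hr' : v + A + T + a + x = v + A + T + b + x)
    (h : v + A + X = v + B + X) : v + A + x = v + B + x := by
  have op {p q : M} : p = q ↔ AddOpposite.op p = AddOpposite.op q :=
    AddOpposite.op_injective.eq_iff.symm
  simp only [op, AddOpposite.op_add] at *
  exact cancel_left_of_sandwich hdb hxd hxd' hT (by rwa [add_assoc]) (by rwa [add_assoc])
    (by rwa [add_assoc]) hA hB hDD hX (by simpa only [add_assoc] using hr)
    (by simpa only [add_assoc] using hr') (by simpa only [add_assoc] using h) |> fun h => by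
      simpa only [add_assoc] using h

section Class

variable {S : Type*} [PSemiring S] {z : S → S} {ξ : S → S → Prop}

theorem IsBLatticeCong.add {a b c d : S} (h : IsBLatticeCong ξ) (h₁ : ξ a b) (h₂ : ξ c d) :
    ξ (a + c) (b + d) :=
  h.1.trans (h.1.addr c h₁) (h.1.addl b h₂)

theorem IsBLatticeCong.add_mem {a b α : S} (h : IsBLatticeCong ξ) (ha : ξ a α) (hb : ξ b α) :
    ξ (a + b) α :=
  h.1.trans (h.add ha hb) (h.2.2.1 α)

theorem IsBLatticeCong.mul_mem {a b α : S} (h : IsBLatticeCong ξ) (ha : ξ a α) (hb : ξ b α) :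
    ξ (a * b) α :=
  h.1.trans (h.1.mulr b ha) (h.1.trans (h.1.mull α hb) (h.2.1 α))

theorem IsBLatticeCong.nmul_mem {a α : S} (h : IsBLatticeCong ξ) (ha : ξ a α) (n : ℕ) :
    ξ (nmul n a) α := by
  induction n with
  | zero => exact ha
  | succ n ih => exact h.add_mem ih ha

/-- A b-lattice congruence compatible with `z` in the way the least one is. -/
structure IsZeroCong (z : S → S) (ξ : S → S → Prop) : Prop where
  zeroMap : IsZeroMap z
  cong : IsBLatticeCong ξ
  domBy : ∀ {a b}, ξ a b → DomBy a b

theorem IsLeastBLatticeCong.isZeroCong (hξ : IsLeastBLatticeCong ξ) (hz : IsZeroMap z) :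
    IsZeroCong z ξ :=
  ⟨hz, hξ.1, fun h => (hξ.2 _ hz.isBLatticeCong_domBy _ _ h).1⟩

/-- `a` absorbs its own zero. -/
def Core (z : S → S) (a : S) : Prop := z a + a = a

theorem IsZeroMap.core_of_addIdem (hz : IsZeroMap z) {e : S} (he : AddIdem e) : Core z e := by
  rw [Core, hz.apply_idem he]
  exact he

theorem Core.add_zero {a : S} (ha : Core z a) (hz : IsZeroMap z) : a + z a = a := by
  rw [← hz.comm]
  exact ha

theorem IsZeroMap.zero_add_zero (hz : IsZeroMap z) (a : S) : z (a + z a) = z a :=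
  hz.ext fun e he =>
    ⟨by rw [left_distrib, hz.idem_mul he]; exact he.mul_right a,
      by rw [right_distrib, hz.mul_idem he]; exact he.mul_left a⟩

theorem IsZeroMap.core_add_zero (hz : IsZeroMap z) (a : S) : Core z (a + z a) := by
  rw [Core, hz.zero_add_zero, ← add_assoc, hz.comm, add_assoc, hz.idem]

namespace IsZeroCong

variable (h : IsZeroCong z ξ)
include h

theorem rel_zero (a : S) : ξ (z a) a := by
  obtain ⟨t, ht⟩ := h.zeroMap.exists_add a
  obtain ⟨n, hn⟩ := h.zeroMap.exists_nmul a
  have hN := h.cong.nmul_mem (h.cong.1.refl a) n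
  have h1 : ξ (a + z a) a := by
    have := h.cong.1.addr (z a) hN
    rw [hn] at this
    exact h.cong.1.trans (h.cong.1.symm this) hN
  have h2 : ξ (a + z a) (z a) := by
    have := h.cong.1.addr t (h.cong.2.2.1 a)
    rwa [add_assoc, ht] at this
  exact h.cong.1.trans (h.cong.1.symm h2) h1

theorem zero_mem {a α : S} (ha : ξ a α) : ξ (z a) α :=
  h.cong.1.trans (h.rel_zero a) ha

theorem exists_compl (a : S) : ∃ t, ξ t a ∧ a + t = z a ∧ t + a + t = t := by
  obtain ⟨t, ht⟩ := h.zeroMap.exists_add a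
  have hz := h.zeroMap.idem a
  have h1 : a + (t + z a) = z a := by rw [← add_assoc, ht]; exact hz
  refine ⟨t + z a, ?_, h1, ?_⟩
  · have h2 := h.cong.1.addl t (h.rel_zero a)
    have h3 := h.cong.2.2.2 t a
    rw [ht] at h3
    exact h.cong.1.trans h2 (h.cong.1.trans h3 (h.rel_zero a))
  · rw [add_assoc _ a, h1, add_assoc, hz]

theorem zero_sandwich {a s : S} (has : ξ a s) : z (a + s + a) = z a :=
  h.zeroMap.ext fun e he => by
    simpa only [left_distrib, right_distrib] using h.domBy has e he

theorem exists_add_right {a s : S} (ha : Core z a) (has : ξ a s) : ∃ t, a + s + t = a := by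
  obtain ⟨t, ht⟩ := h.zeroMap.exists_add (a + s + a)
  rw [h.zero_sandwich has] at ht
  exact ⟨a + t + a, by rw [← add_assoc, ← add_assoc, ht]; exact ha⟩

theorem exists_add_left {a s : S} (ha : Core z a) (has : ξ a s) : ∃ t, t + s + a = a := by
  obtain ⟨t, ht⟩ := h.zeroMap.exists_add' (a + s + a)
  rw [h.zero_sandwich has] at ht
  refine ⟨a + (t + a), ?_⟩
  have := ha.add_zero h.zeroMap
  rw [← ht] at this
  simpa only [add_assoc] using this

theorem zero_add_right_add {x s : S} (hx : Core z x) (hs : ξ x s) : z (x + s) + x = x := by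
  have h1 : z (z (x + s) + x) = z x := by
    rw [← h.zero_sandwich hs]
    exact h.zeroMap.ext fun e he => by
      simp only [left_distrib e _ x, right_distrib _ x e, h.zeroMap.idem_mul he,
        h.zeroMap.mul_idem he, true_and]
  obtain ⟨t, ht⟩ := h.zeroMap.exists_add (z (x + s) + x)
  have h2 : z (x + s) + z x = z x := by
    rw [← h1, ← ht, ← add_assoc, ← add_assoc, h.zeroMap.idem]
  calc z (x + s) + x = z (x + s) + (z x + x) := by rw [show z x + x = x from hx]
    _ = x := by rw [← add_assoc, h2]; exact hx

theorem add_zero_add_left {x s : S} (hx : Core z x) (hs : ξ x s) : x + z (s + x) = x := by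
  have h1 : z (x + z (s + x)) = z x := by
    rw [← h.zero_sandwich hs, add_assoc]
    exact h.zeroMap.ext fun e he => by
      simp only [left_distrib e x, right_distrib x _ e, h.zeroMap.idem_mul he,
        h.zeroMap.mul_idem he, true_and]
  obtain ⟨t, ht⟩ := h.zeroMap.exists_add' (x + z (s + x))
  have h2 : z x + z (s + x) = z x := by
    rw [← h1, ← ht, add_assoc, add_assoc, h.zeroMap.idem]
  have h3 := hx.add_zero h.zeroMap
  calc x + z (s + x) = x + z x + z (s + x) := by rw [h3]
    _ = x := by rw [add_assoc, h2, h3]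

theorem core_add {x s : S} (hx : Core z x) (hs : ξ x s) : Core z (x + s) := by
  rw [Core, ← add_assoc, h.zero_add_right_add hx hs]

theorem core_add' {x s : S} (hx : Core z x) (hs : ξ x s) : Core z (s + x) := by
  rw [Core, h.zeroMap.comm, add_assoc, h.add_zero_add_left hx hs]

theorem add_add_zero {x a : S} (hx : Core z x) (ha : ξ x a) : x + a + z a = x + a := by
  have h1 : z (x + a) = z (x + z a) := h.zeroMap.ext fun e he => by
    simp only [left_distrib, right_distrib, h.zeroMap.idem_mul he, h.zeroMap.mul_idem he,
      and_self]
  have h2 : z (x + a) + z a = z (x + a) := by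
    obtain ⟨t, ht⟩ := h.zeroMap.exists_add' (x + z a)
    rw [h1, ← ht, add_assoc, add_assoc, h.zeroMap.idem]
  have h3 := (h.core_add hx ha).add_zero h.zeroMap
  rw [← h3, add_assoc, h2]

end IsZeroCong

/-- Translation by elements of the class of `α` absorbing their zeros does not separate `a`, `b`. -/
def CoreEq (z : S → S) (ξ : S → S → Prop) (α a b : S) : Prop :=
  ∀ x y, Core z x → ξ x α → Core z y → ξ y α → x + a + y = x + b + y

/-- The additive endomaps of the class of `α` behaving like multiplication by a member. -/
structure IsClassMap (z : S → S) (ξ : S → S → Prop) (α : S) (φ : S → S) : Prop where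
  add : ∀ a b, φ (a + b) = φ a + φ b
  mem : ∀ {a}, ξ a α → ξ (φ a) α
  map_zero : ∀ a, φ (z a) = z (φ a)
  sandwich : ∀ {d}, AddIdem d → ξ d α → φ d + d + φ d = φ d

theorem IsZeroCong.isClassMap_mul_left (h : IsZeroCong z ξ) {c α : S} (hc : ξ c α) :
    IsClassMap z ξ α (c * ·) where
  add := left_distrib c
  mem ha := h.cong.mul_mem hc ha
  map_zero a := by
    rw [← h.zeroMap.apply_idem ((h.zeroMap.idem a).mul_left c)]
    refine h.zeroMap.ext fun e he => ⟨?_, ?_⟩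
    · rw [← mul_assoc, h.zeroMap.idem_mul (he.mul_right c), mul_assoc]
    · rw [mul_assoc, h.zeroMap.mul_idem he, mul_assoc]
  sandwich {d} hd hdα := by
    have h1 := h.zero_sandwich (h.cong.1.trans (h.zero_mem hc) (h.cong.1.symm hdα))
    rw [h.zeroMap.apply_idem (h.zeroMap.idem c)] at h1
    have h2 := h.zeroMap.mul_idem hd (z c + d + z c)
    rwa [h1, right_distrib, right_distrib, h.zeroMap.mul_idem hd,
      h.zeroMap.idem_mul_self hd, eq_comm] at h2

theorem IsZeroCong.isClassMap_mul_right (h : IsZeroCong z ξ) {c α : S} (hc : ξ c α) :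
    IsClassMap z ξ α (· * c) where
  add a b := right_distrib a b c
  mem ha := h.cong.mul_mem ha hc
  map_zero a := by
    rw [← h.zeroMap.apply_idem ((h.zeroMap.idem a).mul_right c)]
    refine h.zeroMap.ext fun e he => ⟨?_, ?_⟩
    · rw [← mul_assoc, h.zeroMap.idem_mul he, mul_assoc]
    · rw [mul_assoc, h.zeroMap.mul_idem (he.mul_left c), mul_assoc]
  sandwich {d} hd hdα := by
    have h1 := h.zero_sandwich (h.cong.1.trans (h.zero_mem hc) (h.cong.1.symm hdα))
    rw [h.zeroMap.apply_idem (h.zeroMap.idem c)] at h1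
    have h2 := h.zeroMap.idem_mul hd (z c + d + z c)
    rwa [h1, left_distrib, left_distrib, h.zeroMap.idem_mul hd,
      h.zeroMap.idem_mul_self hd, eq_comm] at h2

namespace IsZeroCong

theorem core_zero (h : IsZeroCong z ξ) (a : S) : Core z (z a) :=
  h.zeroMap.core_of_addIdem (h.zeroMap.idem a)

/-- The left-hand half of the passage from `CoreEq` for `a`, `b` to `CoreEq` for their images. -/
theorem cancel_left (h : IsZeroCong z ξ) {α a b x v : S} {φ : S → S}
    (hφ : IsClassMap z ξ α φ) (hr : CoreEq z ξ α a b)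
    (ha : Core z a) (haα : ξ a α) (hb : Core z b) (hbα : ξ b α)
    (hx : Core z x) (hxα : ξ x α) (hv : Core z v) (hvα : ξ v α)
    (heq : φ x + φ a + v = φ x + φ b + v) : x + φ a + v = x + φ b + v := by
  have hs {p q : S} (hp : ξ p α) (hq : ξ q α) : ξ p q := h.cong.1.trans hp (h.cong.1.symm hq)
  have ham := hφ.mem haα
  obtain ⟨d, hd⟩ : ∃ d, d = z (a + x) := ⟨_, rfl⟩
  obtain ⟨d', hd'⟩ : ∃ d', d' = z (b + x) := ⟨_, rfl⟩
  have hdi : AddIdem d := hd ▸ h.zeroMap.idem _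
  have hdi' : AddIdem d' := hd' ▸ h.zeroMap.idem _
  have hdα : ξ d α := hd ▸ h.zero_mem (h.cong.add_mem haα hxα)
  have hdα' : ξ d' α := hd' ▸ h.zero_mem (h.cong.add_mem hbα hxα)
  have hda : d + a = a := hd ▸ h.zero_add_right_add ha (hs haα hxα)
  have hdb : d' + b = b := hd' ▸ h.zero_add_right_add hb (hs hbα hxα)
  have hxd : x + d = x := hd ▸ h.add_zero_add_left hx (hs hxα haα)
  have hxd' : x + d' = x := hd' ▸ h.add_zero_add_left hx (hs hxα hbα)
  obtain ⟨T, hTα, hT⟩ : ∃ T, ξ T α ∧ a + T = d := by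
    obtain ⟨t, htα, ht, -⟩ := h.exists_compl (a + x)
    have := h.cong.add_mem haα hxα
    exact ⟨x + t, h.cong.add_mem hxα (h.cong.1.trans htα this), by rw [← add_assoc, ht, hd]⟩
  obtain ⟨t', ht'⟩ : ∃ t', t' + x = d := by
    obtain ⟨t, ht⟩ := h.zeroMap.exists_add' (a + x)
    exact ⟨t + a, by rw [add_assoc, ht, hd]⟩
  obtain ⟨s, hs'⟩ := h.exists_add_left (h.zeroMap.core_of_addIdem hdi') (hs hdα' (hφ.mem hdα))
  have hφd := hφ.sandwich hdi hdα
  have hφd' := hφ.sandwich hdi' hdα'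
  have hTc : Core z (T + φ a + v) := h.core_add' hv (hs hvα (h.cong.add_mem hTα ham))
  have hTm : ξ (T + φ a + v) α := h.cong.add_mem (h.cong.add_mem hTα ham) hvα
  refine cancel_left_of_sandwich (d := d) (d' := d') (T := T) (D := φ d) (D' := φ d') (t := φ t')
    hdb hxd hxd' hT hs' (hφ.sandwich hdi hdα) (hφ.sandwich hdi' hdα') ?_ ?_ ?_ ?_
    (hr (φ d) _ (h.zeroMap.core_of_addIdem (by rw [AddIdem, ← hφ.add, hdi])) (hφ.mem hdα) hTc hTm)
    (hr x _ hx hxα hTc hTm) heq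
  · rw [← hφ.add, hda]
  · rw [← hφ.add, hdb]
  · rw [← hφ.add, ← ht', add_assoc, hxd']
  · exact (hφ.add _ _).symm.trans (congrArg φ ht')

/-- The right-hand half of the passage from `CoreEq` for `a`, `b` to `CoreEq` for their images. -/
theorem cancel_right (h : IsZeroCong z ξ) {α a b x v : S} {φ : S → S}
    (hφ : IsClassMap z ξ α φ) (hr : CoreEq z ξ α a b)
    (ha : Core z a) (haα : ξ a α) (hb : Core z b) (hbα : ξ b α)
    (hx : Core z x) (hxα : ξ x α) (hv : Core z v) (hvα : ξ v α)
    (heq : v + φ a + φ x = v + φ b + φ x) : v + φ a + x = v + φ b + x := by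
  have hs {p q : S} (hp : ξ p α) (hq : ξ q α) : ξ p q := h.cong.1.trans hp (h.cong.1.symm hq)
  have ham := hφ.mem haα
  obtain ⟨d, hd⟩ : ∃ d, d = z (x + a) := ⟨_, rfl⟩
  obtain ⟨d', hd'⟩ : ∃ d', d' = z (x + b) := ⟨_, rfl⟩
  have hdi : AddIdem d := hd ▸ h.zeroMap.idem _
  have hdi' : AddIdem d' := hd' ▸ h.zeroMap.idem _
  have hdα : ξ d α := hd ▸ h.zero_mem (h.cong.add_mem hxα haα)
  have hdα' : ξ d' α := hd' ▸ h.zero_mem (h.cong.add_mem hxα hbα)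
  have hda : a + d = a := hd ▸ h.add_zero_add_left ha (hs haα hxα)
  have hdb : b + d' = b := hd' ▸ h.add_zero_add_left hb (hs hbα hxα)
  have hxd : d + x = x := hd ▸ h.zero_add_right_add hx (hs hxα haα)
  have hxd' : d' + x = x := hd' ▸ h.zero_add_right_add hx (hs hxα hbα)
  obtain ⟨T, hTα, hT⟩ : ∃ T, ξ T α ∧ T + a = d := by
    have hxa := h.cong.add_mem hxα haα
    obtain ⟨t, ht⟩ := h.zeroMap.exists_add' (x + a)
    refine ⟨d + t + x, ?_, by rw [add_assoc, add_assoc, ht, ← hd, hdi]⟩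
    have h1 : ξ (z (x + a) + t + x) (z (x + a) + t + (x + a)) := by
      have := h.cong.1.addl (d + t) (hs hxα hxa)
      rwa [hd] at this
    rw [add_assoc _ t (x + a), ht, h.zeroMap.idem, ← hd] at h1
    exact h.cong.1.trans h1 hdα
  obtain ⟨t', ht'⟩ : ∃ t', x + t' = d := by
    obtain ⟨t, ht⟩ := h.zeroMap.exists_add (x + a)
    exact ⟨a + t, by rw [← add_assoc, ht, hd]⟩
  obtain ⟨s, hs'⟩ := h.exists_add_right (h.zeroMap.core_of_addIdem hdi') (hs hdα' (hφ.mem hdα))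
  have hφd := hφ.sandwich hdi hdα
  have hφd' := hφ.sandwich hdi' hdα'
  have hTc : Core z (v + φ a + T) := by
    rw [add_assoc]
    exact h.core_add hv (hs hvα (h.cong.add_mem ham hTα))
  have hTm : ξ (v + φ a + T) α := h.cong.add_mem (h.cong.add_mem hvα ham) hTα
  refine cancel_right_of_sandwich (d := d) (d' := d') (T := T) (D := φ d) (D' := φ d') (t := φ t')
    hdb hxd hxd' hT hs' (hφ.sandwich hdi hdα) (hφ.sandwich hdi' hdα') ?_ ?_ ?_ ?_
    (hr _ (φ d) hTc hTm (h.zeroMap.core_of_addIdem (by rw [AddIdem, ← hφ.add, hdi])) (hφ.mem hdα))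
    (hr _ x hTc hTm hx hxα) heq
  · rw [← hφ.add, hda]
  · rw [← hφ.add, hdb]
  · rw [← hφ.add, ← ht', ← add_assoc, hxd']
  · exact (hφ.add _ _).symm.trans (congrArg φ ht')

end IsZeroCong
end Class
section Main

variable {S : Type*} [PSemiring S] {z : S → S} {ξ : S → S → Prop}

theorem nmul_add_zero (hz : IsZeroMap z) (n : ℕ) (a : S) :
    nmul n (a + z a) = nmul n a + z a := by
  induction n with
  | zero => rfl
  | succ n ih =>
    change nmul n (a + z a) + (a + z a) = nmul n a + a + z a
    rw [ih, add_assoc, ← add_assoc (z a), hz.comm, add_assoc a, hz.idem, add_assoc]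

/-- An element absorbing its zero, two consecutive multiples of which agree, is idempotent. -/
theorem Core.addIdem_of_nmul_eq (hz : IsZeroMap z) {a : S} (ha : Core z a) {n : ℕ}
    (hn : nmul n a = nmul (n + 1) a) : AddIdem a := by
  induction n with
  | zero => exact hn.symm
  | succ n ih =>
    obtain ⟨t, ht⟩ := hz.exists_add a
    have hc {m : ℕ} : nmul m a + a + t = nmul m a := by
      rw [add_assoc, ht]
      cases m with
      | zero => exact ha.add_zero hz
      | succ m => exact (add_assoc _ a _).trans (congrArg (nmul m a + ·) (ha.add_zero hz))
    apply ih
    have := congrArg (· + t) hn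
    change nmul n a + a + t = nmul (n + 1) a + a + t at this
    rwa [hc, hc] at this

namespace IsZeroCong

theorem coreEq_add_zero (h : IsZeroCong z ξ) {α a b : S} (ha : ξ a α) (hb : ξ b α) :
    CoreEq z ξ α (a + z a) (b + z b) ↔ CoreEq z ξ α a b := by
  have key {a x : S} (ha : ξ a α) (hx : Core z x) (hxα : ξ x α) : x + (a + z a) = x + a := by
    rw [← add_assoc, h.add_add_zero hx (h.cong.1.trans hxα (h.cong.1.symm ha))]
  constructor <;> intro hr x y hx hxα hy hyα
  · simpa only [key ha hx hxα, key hb hx hxα] using hr x y hx hxα hy hyα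
  · simpa only [key ha hx hxα, key hb hx hxα] using hr x y hx hxα hy hyα

theorem coreEq_map (h : IsZeroCong z ξ) {α a b : S} {φ : S → S} (hφ : IsClassMap z ξ α φ)
    (ha : ξ a α) (hb : ξ b α) (hr : CoreEq z ξ α a b) : CoreEq z ξ α (φ a) (φ b) := by
  have hr' := (h.coreEq_add_zero ha hb).2 hr
  have ha' := h.cong.add_mem ha (h.zero_mem ha)
  have hb' := h.cong.add_mem hb (h.zero_mem hb)
  rw [← h.coreEq_add_zero (hφ.mem ha) (hφ.mem hb), ← hφ.map_zero, ← hφ.map_zero, ← hφ.add,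
    ← hφ.add]
  intro x y hx hxα hy hyα
  have hac := h.zeroMap.core_add_zero a
  have hbc := h.zeroMap.core_add_zero b
  have hφx : Core z (φ x) := by
    rw [Core, ← hφ.map_zero, ← hφ.add, show z x + x = x from hx]
  refine h.cancel_left hφ hr' hac ha' hbc hb' hx hxα hy hyα
    (h.cancel_right hφ hr' hac ha' hbc hb' hy hyα hφx (hφ.mem hxα) ?_)
  rw [← hφ.add, ← hφ.add, ← hφ.add, ← hφ.add, hr' x y hx hxα hy hyα]

theorem isCongOn_coreEq (h : IsZeroCong z ξ) (α : S) :
    IsCongOn {x | ξ x α} (CoreEq z ξ α) := by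
  have hs {p q : S} (hp : ξ p α) (hq : ξ q α) : ξ p q := h.cong.1.trans hp (h.cong.1.symm hq)
  refine ⟨fun a _ x y _ _ _ _ => rfl, fun a _ b _ hr x y h1 h2 h3 h4 => (hr x y h1 h2 h3 h4).symm,
    fun a _ b _ c _ hr hr' x y h1 h2 h3 h4 => (hr x y h1 h2 h3 h4).trans (hr' x y h1 h2 h3 h4),
    fun a ha b hb c hc hr => ⟨?_, ?_, h.coreEq_map (h.isClassMap_mul_left hc) ha hb hr,
      h.coreEq_map (h.isClassMap_mul_right hc) ha hb hr⟩⟩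
  · intro x y hx hxα hy hyα
    rw [← add_assoc, ← add_assoc]
    exact hr _ y (h.core_add hx (hs hxα hc)) (h.cong.add_mem hxα hc) hy hyα
  · intro x y hx hxα hy hyα
    have := hr x _ hx hxα (h.core_add' hy (hs hyα hc)) (h.cong.add_mem hc hyα)
    simpa only [add_assoc] using this

theorem genPureOn_coreEq (h : IsZeroCong z ξ) (α : S) :
    GenPureOn {x | ξ x α} (CoreEq z ξ α) := by
  intro a ha e he hei hr
  obtain ⟨n, hn⟩ := h.zeroMap.exists_nmul a
  have hua := h.cong.add_mem ha (h.zero_mem ha)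
  have huc := h.zeroMap.core_add_zero a
  have hr' := (h.coreEq_add_zero ha he).2 hr
  rw [h.zeroMap.apply_idem hei, hei] at hr'
  have h1 := hr' _ _ huc hua (h.zeroMap.core_of_addIdem hei) he
  have hu : AddIdem (a + z a) := by
    obtain ⟨t, ht⟩ := h.exists_add_right huc (h.cong.1.trans hua (h.cong.1.symm he))
    rw [add_assoc _ e e, hei] at h1
    have h2 := congrArg (· + t) h1
    simp only [ht] at h2
    rw [add_assoc, add_assoc, ← add_assoc _ e t, ht] at h2
    exact h2
  have h2 : nmul n a = a + z a := by rw [← hn, ← nmul_add_zero h.zeroMap, hu.nmul_eq]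
  refine ⟨n, ?_⟩
  calc nmul n a = a + z a + (a + z a) := by rw [hu, h2]
    _ = a + (a + z a) := by
      rw [add_assoc, ← add_assoc (z a), h.zeroMap.comm, add_assoc a (z a), h.zeroMap.idem]
    _ = nmul (n + 1) a := by rw [nmul_succ_left, h2]

theorem rel_of_mem_vplus (h : IsZeroCong z ξ) {a v : S} (hv : v ∈ Vplus a) : ξ v a := by
  have key {p q : S} (hpq : p + q + p = p) : ξ (p + q) p := by
    have h1 := h.cong.1.addl p (h.cong.2.2.2 p q)
    have h2 := h.cong.1.addr q (h.cong.2.2.1 p)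
    rw [← add_assoc, ← add_assoc, hpq] at h1
    exact h.cong.1.trans (h.cong.1.symm h2) h1
  exact h.cong.1.trans (h.cong.1.symm (key hv.2))
    (h.cong.1.trans (h.cong.2.2.2 v a) (key hv.1))

/-- Within a class, an idempotent `a + v` makes `a` absorb `v`. -/
theorem add_add_self (h : IsZeroCong z ξ) {a v : S} (ha : Core z a) (hv : ξ a v)
    (hi : AddIdem (a + v)) : a + v + a = a := by
  obtain ⟨s, hs⟩ := h.exists_add_right ha hv
  calc a + v + a = a + v + (a + v) + s := by rw [add_assoc _ _ s, hs]
    _ = a := by rw [hi, hs]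

theorem coreEq_of_yrel (h : IsZeroCong z ξ) {a b : S} (hab : Yrel z a b) :
    ξ b a ∧ CoreEq z ξ a a b := by
  have ham : ξ (a + z a) a := h.cong.add_mem (h.cong.1.refl a) (h.rel_zero a)
  have hbm : ξ (b + z b) b := h.cong.add_mem (h.cong.1.refl b) (h.rel_zero b)
  have hac := h.zeroMap.core_add_zero a
  have hs {p q : S} (hp : ξ p a) (hq : ξ q a) : ξ p q := h.cong.1.trans hp (h.cong.1.symm hq)
  have key {x y : S} (hx : Core z x) (hxa : ξ x a) (hy : Core z y) (hya : ξ y a) :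
      ∃ v ∈ Vplus (a + z a), (∃ s, s + v = x) ∧ ∃ s, v + s = y := by
    obtain ⟨t, ht, hwt, htw⟩ := h.exists_compl (x + (a + z a) + y)
    have hwm : ξ (x + (a + z a) + y) a := h.cong.add_mem (h.cong.add_mem hxa ham) hya
    have htm := h.cong.1.trans ht hwm
    have hvm : ξ (y + t + x) a := h.cong.add_mem (h.cong.add_mem hya htm) hxa
    have h1 : y + t + x + (a + z a) + (y + t + x) = y + t + x := by
      calc _ = y + (t + (x + (a + z a) + y) + t) + x := by simp only [add_assoc]
        _ = y + t + x := by rw [htw]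
    have h2 : AddIdem (a + z a + (y + t + x)) := by
      rw [AddIdem, add_assoc, ← add_assoc _ (a + z a), h1]
    refine ⟨_, ⟨h.add_add_self hac (hs ham hvm) h2, h1⟩, ?_, ?_⟩
    · obtain ⟨s, hs'⟩ := h.exists_add_left hx (hs hxa (h.cong.add_mem hya htm))
      exact ⟨s, by rw [← add_assoc, hs']⟩
    · obtain ⟨s, hs'⟩ := h.exists_add_right hy (hs hya (h.cong.add_mem htm hxa))
      exact ⟨s, by simpa only [add_assoc] using hs'⟩
  have hba : ξ b a := by
    obtain ⟨v, hv, -⟩ := key (h.core_zero a) (h.rel_zero a) (h.core_zero a) (h.rel_zero a)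
    have h1 := h.rel_of_mem_vplus hv
    have h2 := h.rel_of_mem_vplus (hab ▸ hv)
    exact h.cong.1.trans (h.cong.1.symm hbm)
      (h.cong.1.trans (h.cong.1.symm h2) (h.cong.1.trans h1 ham))
  refine ⟨hba, (h.coreEq_add_zero (h.cong.1.refl a) hba).1 ?_⟩
  intro x y hx hxa hy hya
  obtain ⟨v, hv, ⟨s, rfl⟩, ⟨s', rfl⟩⟩ := key hx hxa hy hya
  have hv' : v ∈ Vplus (b + z b) := hab ▸ hv
  calc s + v + (a + z a) + (v + s') = s + (v + (a + z a) + v) + s' := by simp only [add_assoc]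
    _ = s + (v + (b + z b) + v) + s' := by rw [hv.2, hv'.2]
    _ = s + v + (b + z b) + (v + s') := by simp only [add_assoc]

/-- If all elements absorb their zeros, pure congruences on classes preserve inverses. -/
theorem vplus_subset_of_pure (h : IsZeroCong z ξ) (hK : ∀ a : S, Core z a) {α a b : S}
    {r : S → S → Prop} (hr : IsCongOn {x | ξ x α} r) (hp : GenPureOn {x | ξ x α} r)
    (ha : ξ a α) (hb : ξ b α) (hab : r a b) : Vplus a ⊆ Vplus b := by
  intro v hv
  have hvm : ξ v α := h.cong.1.trans (h.rel_of_mem_vplus hv) ha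
  have hs {p q : S} (hp : ξ p α) (hq : ξ q α) : ξ p q := h.cong.1.trans hp (h.cong.1.symm hq)
  obtain ⟨h1, h2, -⟩ := hr.2.2.2 b hb a ha v hvm (hr.2.1 a ha b hb hab)
  have hva : AddIdem (v + a) := by rw [AddIdem, ← add_assoc, hv.2]
  have hav : AddIdem (a + v) := by rw [AddIdem, ← add_assoc, hv.1]
  obtain ⟨n, hn⟩ := hp _ (h.cong.add_mem hvm hb) _ (h.cong.add_mem hvm ha) hva h1
  obtain ⟨m, hm⟩ := hp _ (h.cong.add_mem hb hvm) _ (h.cong.add_mem ha hvm) hav h2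
  exact ⟨h.add_add_self (hK b) (hs hb hvm) ((hK _).addIdem_of_nmul_eq h.zeroMap hm),
    h.add_add_self (hK v) (hs hvm hb) ((hK _).addIdem_of_nmul_eq h.zeroMap hn)⟩

end IsZeroCong

theorem isCong_eq : IsCong (Eq : S → S → Prop) :=
  ⟨fun _ => rfl, Eq.symm, Eq.trans, fun c _ _ => congrArg (c + ·), fun c _ _ => congrArg (· + c),
    fun c _ _ => congrArg (c * ·), fun c _ _ => congrArg (· * c)⟩

end Main
end PSemiring

/-- For a quasi completely regular semiring `S` with least
b-lattice congruence `ξ`, the least congruence `𝒴*` containing `𝒴` is the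
equality relation iff on every `ξ`-class (as a subsemiring of `S`) the
equality relation is the unique generalized additive idempotent pure
congruence. -/
theorem ystar_trivial_iff_unique_pure {S : Type*} [PSemiring S]
    (hS : QuasiCompletelyRegular S) (z : S → S) (hz : ∀ a, IsZeroOf a (z a))
    (ξ : S → S → Prop) (hξ : IsLeastBLatticeCong ξ)
    (Ystar : S → S → Prop) (hY : IsLeastCongContaining (Yrel z) Ystar) :
    (∀ a b : S, Ystar a b ↔ a = b) ↔
      ∀ α : S, ∀ r : S → S → Prop,
        IsCongOn {x | ξ x α} r → GenPureOn {x | ξ x α} r →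
        ∀ a ∈ {x | ξ x α}, ∀ b ∈ {x | ξ x α}, r a b → a = b := by
  have h := hξ.isZeroCong (isZeroMap_of_isZeroOf hS hz)
  constructor
  · intro hYe α r hr hp a ha b hb hab
    have hfix (a : S) : a = a + z a := by
      refine (hYe _ _).1 (hY.2.1 _ _ ?_)
      rw [Yrel, h.zeroMap.zero_add_zero, add_assoc, h.zeroMap.idem]
    have hK (a : S) : Core z a := by
      rw [Core, h.zeroMap.comm, ← hfix]
    refine (hYe _ _).1 (hY.2.1 _ _ ?_)
    rw [Yrel, ← hfix, ← hfix]
    exact (h.vplus_subset_of_pure hK hr hp ha hb hab).antisymm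
      (h.vplus_subset_of_pure hK hr hp hb ha (hr.2.1 a ha b hb hab))
  · intro hpure a b
    refine ⟨hY.2.2 _ isCong_eq (fun a b hab => ?_) a b, fun hab => hab ▸ hY.1.refl a⟩
    obtain ⟨hba, hr⟩ := h.coreEq_of_yrel hab
    exact hpure a _ (h.isCongOn_coreEq a) (h.genPureOn_coreEq a) a (h.cong.1.refl a) b hba hr
end

section
/- Let S be a quasi completely regular semiring. Then ε ⊆ 𝒴* ⊆ ν, i.e., the least congruence 𝒴* containing 𝒴 lies in the interval [ε, ν], where ε is the equality congruence and ν is the least b-lattice-of-skew-rings congruence on S. -/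
open PSemiring

namespace PSemiring

variable {S : Type*} [PSemiring S]

theorem add_nmul_comm (n : ℕ) (a : S) : a + nmul n a = nmul n a + a := by
  induction n with
  | zero => rfl
  | succ k ih => rw [nmul, ← add_assoc, ih]

theorem exists_add_eq_nmul_add_nmul (n : ℕ) (a : S) :
    ∃ w, a + w = nmul n a + nmul n a := by
  cases n with
  | zero => exact ⟨a, rfl⟩
  | succ k => exact ⟨nmul k a + nmul (k + 1) a, by rw [← add_assoc, add_nmul_comm]; rfl⟩

/-- If a multiple of `a` lies in an additive subgroup with identity `e`, then `a + e` has an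
additive inverse. -/
theorem Vplus_add_nonempty {a z : S} (h : IsZeroOf a z) : (Vplus (a + z)).Nonempty := by
  obtain ⟨n, x, -, hm, hx, hc, rfl⟩ := h
  obtain ⟨w, hw⟩ := exists_add_eq_nmul_add_nmul n a
  have ha := add_nmul_comm n a
  generalize nmul n a = m at *
  have hem : m + x + m = m := hm.symm
  have h₁ : a + (m + x) = m + x + a + (m + x) := by
    calc a + (m + x) = m + a + x := by rw [← add_assoc, ha]
      _ = m + x + (m + a) + x := by rw [← add_assoc (m + x), hem]
      _ = m + x + a + (m + x) := by rw [← ha]; simp only [add_assoc]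
  have h₂ : m + x + a = m + x + a + (m + x) := by
    calc m + x + a = x + (a + m) := by rw [hc, ha, add_assoc]
      _ = x + (a + (m + x + m)) := by rw [hem]
      _ = x + (a + m) + (x + m) := by simp only [add_assoc]
      _ = m + x + a + (m + x) := by rw [ha, hc, add_assoc x m a]
  have hcomm : a + (m + x) = m + x + a := h₁.trans h₂.symm
  have hxx : m + x + x = x := by rw [hc, ← hx]
  have hidem : m + x + (m + x) = m + x := by rw [← add_assoc, hem]
  have hinv : a + (m + x) + (w + x + x) = m + x := by
    calc a + (m + x) + (w + x + x) = m + x + (a + w) + x + x := by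
          rw [hcomm]; simp only [add_assoc]
      _ = m + x + m + (m + x + x) := by rw [hw]; simp only [add_assoc]
      _ = m + x := by rw [hem, hxx]
  have hreg : a + (m + x) + (w + x + x) + (a + (m + x)) = a + (m + x) := by
    rw [hinv, ← add_assoc, ← h₁]
  generalize a + (m + x) = c at *
  generalize w + x + x = t at *
  refine ⟨t + c + t, ?_, ?_⟩
  · calc c + (t + c + t) + c = c + t + c + t + c := by simp only [add_assoc]
      _ = c := by rw [hreg, hreg]
  · calc t + c + t + c + (t + c + t) = t + (c + t + c + t + c) + t := by simp only [add_assoc]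
      _ = t + c + t := by rw [hreg, hreg]

variable {η ξ : S → S → Prop}

/-- Mutually inverse elements are congruent modulo any congruence whose quotient has a
semilattice as additive reduct. -/
theorem rel_of_mem_Vplus (hξ : IsCong ξ) (hidem : ∀ a : S, ξ (a + a) a)
    (hcomm : ∀ a b : S, ξ (a + b) (b + a)) {c x : S} (h : x ∈ Vplus c) : ξ c x := by
  have key : ∀ {c x : S}, c + x + c = c → ξ c (c + x) := fun {c x} h => by
    have h₁ := hcomm (c + x) c
    rw [h, ← add_assoc] at h₁
    exact hξ.trans h₁ (hξ.addr x (hidem c))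
  exact hξ.trans (hξ.trans (key h.1) (hcomm c x)) (hξ.symm (key h.2))

theorem rel_nmul (hξ : IsCong ξ) (hidem : ∀ a : S, ξ (a + a) a) (n : ℕ) (a : S) :
    ξ (nmul n a) a := by
  induction n with
  | zero => exact hξ.refl a
  | succ k ih => exact hξ.trans (hξ.addr a ih) (hidem a)

/-- The element `0_a` is an additive idempotent. -/
theorem IsZeroOf.addIdem {a z : S} (h : IsZeroOf a z) : AddIdem z := by
  obtain ⟨n, x, -, hm, -, -, rfl⟩ := h
  rw [AddIdem, ← add_assoc, ← hm]

theorem IsZeroOf.rel (hξ : IsCong ξ) (hidem : ∀ a : S, ξ (a + a) a)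
    (hcomm : ∀ a b : S, ξ (a + b) (b + a)) {a z : S} (h : IsZeroOf a z) : ξ z a := by
  obtain ⟨n, x, -, hm, hx, -, rfl⟩ := h
  have hmx : ξ (nmul n a) x := rel_of_mem_Vplus hξ hidem hcomm ⟨hm.symm, hx.symm⟩
  exact hξ.trans (hξ.trans (hξ.addl _ (hξ.symm hmx)) (hidem _)) (rel_nmul hξ hidem n a)

theorem AddIdem.add_rel_right (hη : IsCong η) {e f : S} (he : AddIdem e)
    (h : ∃ x, η (e + x) f) : η (e + f) f := by
  obtain ⟨x, hx⟩ := h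
  have h₁ := hη.addl e hx
  rw [← add_assoc, he] at h₁
  exact hη.trans (hη.symm h₁) hx

theorem AddIdem.add_rel_left (hη : IsCong η) {e f : S} (he : AddIdem e)
    (h : ∃ y, η (y + e) f) : η (f + e) f := by
  obtain ⟨y, hy⟩ := h
  have h₁ := hη.addr e hy
  rw [add_assoc, he] at h₁
  exact hη.trans (hη.symm h₁) hy

/-- Modulo a b-lattice-of-skew-rings congruence, additive inverses are unique, and hence
`𝒴`-related elements are identified. -/
theorem IsBLSRCong.rel_of_Yrel (h : IsBLSRCong η) {z : S → S} (hz : ∀ a, IsZeroOf a (z a))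
    {a b : S} (hab : Yrel z a b) : η a b := by
  obtain ⟨hη, ξ, hξ, -, -, hidem, hcomm, -, hgrp⟩ := h
  have left : ∀ {e f : S}, AddIdem e → ξ e f → η (e + f) f := fun he hef =>
    he.add_rel_right hη ((hgrp _ _ hef).1.imp fun _ => And.right)
  have right : ∀ {e f : S}, AddIdem e → ξ e f → η (f + e) f := fun he hef =>
    he.add_rel_left hη ((hgrp _ _ hef).2.imp fun _ => And.right)
  have hzero : ∀ a, η (a + z a) a := fun a => right (hz a).addIdem ((hz a).rel hξ hidem hcomm)
  obtain ⟨x, hx⟩ := Vplus_add_nonempty (hz a)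
  have hx' : x ∈ Vplus (b + z b) := hab ▸ hx
  refine hη.trans (hη.symm (hzero a)) (hη.trans ?_ (hzero b))
  generalize a + z a = c at hx
  generalize b + z b = d at hx'
  have hcx := rel_of_mem_Vplus hξ hidem hcomm hx
  have hdx := rel_of_mem_Vplus hξ hidem hcomm hx'
  have hcd := hξ.trans hcx (hξ.symm hdx)
  have he : AddIdem (c + x) := by rw [AddIdem, ← add_assoc, hx.1]
  have hg : AddIdem (x + d) := by rw [AddIdem, ← add_assoc, hx'.2]
  have hed : ξ (c + x) d :=
    hξ.trans (hξ.trans (hξ.addl c (hξ.symm hcx)) (hidem c)) hcd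
  have hgc : ξ (x + d) c :=
    hξ.trans (hξ.trans (hξ.addr d (hξ.symm hdx)) (hidem d)) (hξ.symm hcd)
  have h₁ := right hg hgc
  rw [← add_assoc] at h₁
  exact hη.trans (hη.symm h₁) (left he hed)

end PSemiring

/-- For a quasi completely regular semiring `S`,
`ε ⊆ 𝒴* ⊆ ν`: the least congruence `𝒴*` containing `𝒴` lies in the interval
`[ε, ν]`, where `ε` is the equality congruence and `ν` is the least
b-lattice-of-skew-rings congruence. -/
theorem ystar_mem_interval {S : Type*} [PSemiring S]
    (hS : QuasiCompletelyRegular S) (z : S → S) (hz : ∀ a, IsZeroOf a (z a))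
    (Ystar : S → S → Prop) (hY : IsLeastCongContaining (Yrel z) Ystar)
    (ν : S → S → Prop) (hν : IsLeastBLSRCong ν) :
    (∀ a b : S, a = b → Ystar a b) ∧ ∀ a b : S, Ystar a b → ν a b := by
  refine ⟨fun a b h => h ▸ hY.1.refl a, ?_⟩
  exact hY.2.2 ν hν.1.1 fun a b => hν.1.rel_of_Yrel hz
end
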